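/- arXiv:1306.2236 — 2 statements merged into one kernel-verified Lean document; each statement's English description precedes it below -/
import Mathlib

section
/- Let Y be a real random variable and B > 0. Let g⁻ and g⁺ be positive, non-decreasing functions on (0,∞) such that x/g⁻(x) and x/g⁺(x) are non-decreasing for x > 0. Set Y⁻ = max{−Y, 0}, Y⁺ = max{Y, 0}, g⁻_Y = E[(Y⁻)^2 g⁻(Y⁻)] and g⁺_Y = E[(Y⁺)^2 g⁺(Y⁺)] (with the convention that the integrand is 0 where Y⁻ = 0, respectively Y⁺ = 0), assumed finite. Then E[Y^2 · 1{|Y| ≥ √B}] ≤ g⁻_Y/g⁻(√B) + g⁺_Y/g⁺(√B) and E[|Y|^3 · 1{|Y| < √B}] ≤ √B · ( g⁻_Y/g⁻(√B) + g⁺_Y/g⁺(√B) ). -/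
open MeasureTheory ProbabilityTheory Real

/-- The weighted square `(x⁺)² g(x⁺)`, set to `0` where `x⁺ = 0`. -/
noncomputable def posPartSqWeight (g : ℝ → ℝ) (x : ℝ) : ℝ :=
  if max x 0 = 0 then 0 else max x 0 ^ 2 * g (max x 0)

lemma posPartSqWeight_of_pos (g : ℝ → ℝ) {x : ℝ} (hx : 0 < x) :
    posPartSqWeight g x = x ^ 2 * g x := by
  simp [posPartSqWeight, max_eq_left hx.le, hx.ne']

lemma posPartSqWeight_nonneg {g : ℝ → ℝ} (hg : ∀ x : ℝ, 0 < x → 0 < g x) (x : ℝ) :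
    0 ≤ posPartSqWeight g x := by
  rcases le_or_gt x 0 with hx | hx
  · simp [posPartSqWeight, max_eq_right hx]
  · rw [posPartSqWeight_of_pos g hx]
    have := hg x hx
    positivity

lemma sq_le_posPartSqWeight_div {g : ℝ → ℝ} (hg : ∀ x : ℝ, 0 < x → 0 < g x)
    (hmono : ∀ x y : ℝ, 0 < x → x ≤ y → g x ≤ g y) {s x : ℝ} (hs : 0 < s) (hx : s ≤ x) :
    x ^ 2 ≤ posPartSqWeight g x / g s := by
  rw [posPartSqWeight_of_pos g (hs.trans_le hx), le_div_iff₀ (hg s hs)]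
  exact mul_le_mul_of_nonneg_left (hmono s x hs hx) (sq_nonneg x)

lemma cube_le_mul_posPartSqWeight_div {g : ℝ → ℝ} (hg : ∀ x : ℝ, 0 < x → 0 < g x)
    (hdiv : ∀ x y : ℝ, 0 < x → x ≤ y → x / g x ≤ y / g y) {s x : ℝ} (hx : 0 < x)
    (hxs : x ≤ s) : x ^ 3 ≤ s * (posPartSqWeight g x / g s) := by
  have hs := hx.trans_le hxs
  have h := hdiv x s hx hxs
  rw [div_le_div_iff₀ (hg x hx) (hg s hs)] at h
  rw [posPartSqWeight_of_pos g hx, ← mul_div_assoc, le_div_iff₀ (hg s hs)]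
  calc x ^ 3 * g s = x ^ 2 * (x * g s) := by ring
    _ ≤ x ^ 2 * (s * g x) := mul_le_mul_of_nonneg_left h (sq_nonneg x)
    _ = s * (x ^ 2 * g x) := by ring

/-- A nonnegative function bounded on a measurable set by a nonnegative integrable function has
set integral at most the full integral of the bound. -/
lemma setIntegral_le_integral_of_le_on {Ω : Type*} [MeasurableSpace Ω] {μ : Measure Ω}
    {f F : Ω → ℝ} {s : Set Ω} (hs : MeasurableSet s) (hf : ∀ ω, 0 ≤ f ω) (hF : ∀ ω, 0 ≤ F ω)
    (hFint : Integrable F μ) (hle : ∀ ω ∈ s, f ω ≤ F ω) :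
    ∫ ω in s, f ω ∂μ ≤ ∫ ω, F ω ∂μ := by
  rw [← integral_indicator hs]
  exact integral_mono_of_nonneg (.of_forall fun ω => Set.indicator_nonneg (fun ω _ => hf ω) ω)
    hFint (.of_forall fun ω => Set.indicator_le' hle (fun ω _ => hF ω) ω)

/-- One-sided weighted-moment bounds for the truncated second and third moments, with
separate weights `g⁻`, `g⁺` for the negative and positive parts of `Y`. -/
theorem truncated_moments_le_one_sided_weighted_moments
    {Ω : Type} [MeasurableSpace Ω] (P : Measure Ω) [IsProbabilityMeasure P]
    (Y : Ω → ℝ) (hYmeas : Measurable Y) (B : ℝ) (hB : 0 < B)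
    (gm gp : ℝ → ℝ)
    (hgmpos : ∀ x : ℝ, 0 < x → 0 < gm x) (hgppos : ∀ x : ℝ, 0 < x → 0 < gp x)
    (hgmmono : ∀ x y : ℝ, 0 < x → x ≤ y → gm x ≤ gm y)
    (hgpmono : ∀ x y : ℝ, 0 < x → x ≤ y → gp x ≤ gp y)
    (hxdivgm : ∀ x y : ℝ, 0 < x → x ≤ y → x / gm x ≤ y / gm y)
    (hxdivgp : ∀ x y : ℝ, 0 < x → x ≤ y → x / gp x ≤ y / gp y)
    (gmY gpY : ℝ)
    (hgmY : gmY = ∫ ω, (if max (-Y ω) 0 = 0 then 0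
      else max (-Y ω) 0 ^ 2 * gm (max (-Y ω) 0)) ∂P)
    (hgpY : gpY = ∫ ω, (if max (Y ω) 0 = 0 then 0
      else max (Y ω) 0 ^ 2 * gp (max (Y ω) 0)) ∂P)
    (hgmint : Integrable (fun ω => if max (-Y ω) 0 = 0 then 0
      else max (-Y ω) 0 ^ 2 * gm (max (-Y ω) 0)) P)
    (hgpint : Integrable (fun ω => if max (Y ω) 0 = 0 then 0
      else max (Y ω) 0 ^ 2 * gp (max (Y ω) 0)) P) :
    (∫ ω in {ω | Real.sqrt B ≤ |Y ω|}, Y ω ^ 2 ∂P)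
        ≤ gmY / gm (Real.sqrt B) + gpY / gp (Real.sqrt B)
      ∧ (∫ ω in {ω | |Y ω| < Real.sqrt B}, |Y ω| ^ 3 ∂P)
        ≤ Real.sqrt B * (gmY / gm (Real.sqrt B) + gpY / gp (Real.sqrt B)) := by
  set s := Real.sqrt B
  have hs : 0 < s := Real.sqrt_pos.2 hB
  change Integrable (fun ω => posPartSqWeight gm (-Y ω)) P at hgmint
  change Integrable (fun ω => posPartSqWeight gp (Y ω)) P at hgpint
  change gmY = ∫ ω, posPartSqWeight gm (-Y ω) ∂P at hgmY
  change gpY = ∫ ω, posPartSqWeight gp (Y ω) ∂P at hgpY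
  have hm0 (ω : Ω) : 0 ≤ posPartSqWeight gm (-Y ω) / gm s :=
    div_nonneg (posPartSqWeight_nonneg hgmpos _) (hgmpos s hs).le
  have hp0 (ω : Ω) : 0 ≤ posPartSqWeight gp (Y ω) / gp s :=
    div_nonneg (posPartSqWeight_nonneg hgppos _) (hgppos s hs).le
  let F : Ω → ℝ := fun ω => posPartSqWeight gm (-Y ω) / gm s + posPartSqWeight gp (Y ω) / gp s
  have hF0 (ω : Ω) : 0 ≤ F ω := add_nonneg (hm0 ω) (hp0 ω)
  have hFint : Integrable F P := (hgmint.div_const _).add (hgpint.div_const _)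
  have hF : gmY / gm s + gpY / gp s = ∫ ω, F ω ∂P := by
    rw [integral_add (hgmint.div_const _) (hgpint.div_const _), integral_div, integral_div,
      hgmY, hgpY]
  rw [hF, ← integral_const_mul]
  constructor
  · refine setIntegral_le_integral_of_le_on (measurableSet_le measurable_const hYmeas.abs)
      (fun ω => sq_nonneg _) hF0 hFint fun ω hω => ?_
    rcases le_abs.1 (show s ≤ |Y ω| from hω) with h | h
    · exact (sq_le_posPartSqWeight_div hgppos hgpmono hs h).trans
        (le_add_of_nonneg_left (hm0 ω))
    · rw [← neg_sq]
      exact (sq_le_posPartSqWeight_div hgmpos hgmmono hs h).trans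
        (le_add_of_nonneg_right (hp0 ω))
  · refine setIntegral_le_integral_of_le_on (measurableSet_lt hYmeas.abs measurable_const)
      (fun ω => by positivity) (fun ω => mul_nonneg hs.le (hF0 ω)) (hFint.const_mul s)
      fun ω hω => ?_
    have hlt : |Y ω| < s := hω
    rcases lt_trichotomy (Y ω) 0 with h | h | h
    · rw [abs_of_neg h] at hlt ⊢
      exact (cube_le_mul_posPartSqWeight_div hgmpos hxdivgm (neg_pos.2 h) hlt.le).trans
        (mul_le_mul_of_nonneg_left (le_add_of_nonneg_right (hp0 ω)) hs.le)
    · have h0 : |Y ω| ^ 3 = 0 := by simp [h]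
      rw [h0]
      exact mul_nonneg hs.le (hF0 ω)
    · rw [abs_of_pos h] at hlt ⊢
      exact (cube_le_mul_posPartSqWeight_div hgppos hxdivgp h hlt.le).trans
        (mul_le_mul_of_nonneg_left (le_add_of_nonneg_left (hm0 ω)) hs.le)
end

section
/- Let n ≥ 2, let (d_{ij}) be an n×n real matrix and let π be a uniformly distributed random permutation of {1,…,n}. Set T = Σ_{i=1}^n d_{iπ(i)}, d_{i·} = (1/n) Σ_{j=1}^n d_{ij}, d_{·j} = (1/n) Σ_{i=1}^n d_{ij} and d_{··} = (1/n²) Σ_{i,j=1}^n d_{ij}. Then E T = n d_{··} and Var T = (1/(n−1)) Σ_{i,j=1}^n (d_{ij} − d_{i·} − d_{·j} + d_{··})^2. -/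
open MeasureTheory ProbabilityTheory Real

/-- The marginal of a uniform permutation at a point is uniform. -/
theorem card_mul_sum_perm_apply {ι : Type*} [Fintype ι] [DecidableEq ι] (f : ι → ℝ) (i : ι) :
    (Fintype.card ι : ℝ) * ∑ σ : Equiv.Perm ι, f (σ i)
      = (Fintype.card (Equiv.Perm ι) : ℝ) * ∑ j, f j := by
  have h : ∀ k, ∑ σ : Equiv.Perm ι, f (σ k) = ∑ σ : Equiv.Perm ι, f (σ i) := fun k =>
    Fintype.sum_equiv (Equiv.mulRight (Equiv.swap k i)) _ _ (by simp)
  calc (Fintype.card ι : ℝ) * ∑ σ : Equiv.Perm ι, f (σ i)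
      = ∑ k, ∑ σ : Equiv.Perm ι, f (σ k) := by simp [h]
    _ = ∑ σ : Equiv.Perm ι, ∑ k, f (σ k) := Finset.sum_comm
    _ = _ := by simp [Equiv.sum_comp]

/-- Mixed second moments of a uniform permutation at two distinct points, for a centered
second factor. -/
theorem card_sub_one_mul_sum_perm_mul {ι : Type*} [Fintype ι] [DecidableEq ι] (f g : ι → ℝ)
    (hg : ∑ j, g j = 0) {i k : ι} (hik : k ≠ i) :
    ((Fintype.card ι : ℝ) - 1) * ∑ σ : Equiv.Perm ι, f (σ i) * g (σ k)
      = -∑ σ : Equiv.Perm ι, f (σ i) * g (σ i) := by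
  have h : ∀ l ∈ Finset.univ.erase i, ∑ σ : Equiv.Perm ι, f (σ i) * g (σ l)
      = ∑ σ : Equiv.Perm ι, f (σ i) * g (σ k) := fun l hl =>
    Fintype.sum_equiv (Equiv.mulRight (Equiv.swap l k)) _ _ (by
      simp [Equiv.swap_apply_of_ne_of_ne (Finset.ne_of_mem_erase hl).symm hik.symm])
  have hzero : ∑ l, ∑ σ : Equiv.Perm ι, f (σ i) * g (σ l) = 0 := by
    rw [Finset.sum_comm]
    simp [← Finset.mul_sum, Equiv.sum_comp, hg]
  rw [← Finset.add_sum_erase _ _ (Finset.mem_univ i), Finset.sum_congr rfl h,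
    Finset.sum_const, Finset.card_erase_of_mem (Finset.mem_univ i), nsmul_eq_mul,
    Finset.card_univ, Nat.cast_pred (Fintype.card_pos_iff.mpr ⟨i⟩)] at hzero
  linarith

/-- The second moment of `Σᵢ e i (σ i)` for a doubly centered matrix `e`. -/
theorem card_sub_one_mul_sum_perm_sq {ι : Type*} [Fintype ι] [DecidableEq ι]
    (e : ι → ι → ℝ)
    (hrow : ∀ i, ∑ j, e i j = 0) (hcol : ∀ j, ∑ i, e i j = 0) :
    ((Fintype.card ι : ℝ) - 1) * ∑ σ : Equiv.Perm ι, (∑ i, e i (σ i)) ^ 2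
      = (Fintype.card (Equiv.Perm ι) : ℝ) * ∑ i, ∑ j, e i j ^ 2 := by
  have key : ∀ i, ((Fintype.card ι : ℝ) - 1) *
      ∑ k, ∑ σ : Equiv.Perm ι, e i (σ i) * e k (σ k)
      = (Fintype.card ι : ℝ) * ∑ σ : Equiv.Perm ι, e i (σ i) * e i (σ i) := by
    intro i
    have hsum : ∑ k, ∑ σ : Equiv.Perm ι, e i (σ i) * e k (σ i) = 0 := by
      rw [Finset.sum_comm]
      simp [← Finset.mul_sum, hcol]
    rw [← Finset.add_sum_erase _ _ (Finset.mem_univ i)] at hsum ⊢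
    rw [mul_add, Finset.mul_sum (Finset.univ.erase i), Finset.sum_congr rfl fun k hk =>
      card_sub_one_mul_sum_perm_mul (e i) (e k) (hrow k) (Finset.ne_of_mem_erase hk),
      Finset.sum_neg_distrib]
    linarith
  have hswap : ∑ σ : Equiv.Perm ι, (∑ i, e i (σ i)) ^ 2
      = ∑ i, ∑ k, ∑ σ : Equiv.Perm ι, e i (σ i) * e k (σ k) := by
    simp_rw [sq, Finset.sum_mul_sum]
    rw [Finset.sum_comm]
    exact Finset.sum_congr rfl fun i _ => Finset.sum_comm
  rw [hswap, Finset.mul_sum, Finset.mul_sum]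
  refine Finset.sum_congr rfl fun i _ => ?_
  rw [key, card_mul_sum_perm_apply fun j => e i j * e i j]
  simp_rw [sq]

/-- The expectation of a function of a uniform permutation is its average. -/
theorem integral_comp_uniform_perm {Ω : Type*} [MeasurableSpace Ω] (P : Measure Ω)
    [IsProbabilityMeasure P] {n : ℕ} (perm : Ω → Equiv.Perm (Fin n))
    (hmeas : @Measurable Ω (Equiv.Perm (Fin n)) _ ⊤ perm)
    (hunif : ∀ s : Equiv.Perm (Fin n), P {ω | perm ω = s} = (n.factorial : ENNReal)⁻¹)
    (g : Equiv.Perm (Fin n) → ℝ) :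
    ∫ ω, g (perm ω) ∂P = (n.factorial : ℝ)⁻¹ * ∑ s, g s := by
  let _ : MeasurableSpace (Equiv.Perm (Fin n)) := ⊤
  have : MeasurableSingletonClass (Equiv.Perm (Fin n)) := ⟨fun _ => trivial⟩
  have : IsProbabilityMeasure (P.map perm) := Measure.isProbabilityMeasure_map hmeas.aemeasurable
  rw [← integral_map (φ := perm) (f := g) hmeas.aemeasurable
    (measurable_from_top : Measurable g).aestronglyMeasurable,
    integral_fintype (Integrable.of_finite), Finset.mul_sum]
  refine Finset.sum_congr rfl fun s _ => ?_
  have hs : P.map perm {s} = (n.factorial : ENNReal)⁻¹ := by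
    rw [Measure.map_apply hmeas trivial]
    exact hunif s
  simp [Measure.real, hs]


/-- Mean and variance of `T = Σᵢ d_{iπ(i)}` for a uniform random permutation `π`. -/
theorem perm_sum_mean_and_variance
    {Ω : Type} [MeasurableSpace Ω] (P : Measure Ω) [IsProbabilityMeasure P]
    {n : ℕ} (hn : 2 ≤ n) (d : Fin n → Fin n → ℝ)
    (perm : Ω → Equiv.Perm (Fin n))
    (hpermMeas : @Measurable Ω (Equiv.Perm (Fin n)) _ ⊤ perm)
    (hpermUnif : ∀ s : Equiv.Perm (Fin n), P {ω | perm ω = s} = (n.factorial : ENNReal)⁻¹) :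
    (∫ ω, (∑ i, d i (perm ω i)) ∂P = (n : ℝ) * (((n : ℝ) ^ 2)⁻¹ * ∑ i, ∑ j, d i j))
      ∧ variance (fun ω => ∑ i, d i (perm ω i)) P
        = ((n : ℝ) - 1)⁻¹ * ∑ i, ∑ j,
            (d i j - (n : ℝ)⁻¹ * ∑ l, d i l - (n : ℝ)⁻¹ * ∑ k, d k j
              + ((n : ℝ) ^ 2)⁻¹ * ∑ k, ∑ l, d k l) ^ 2 := by
  have hn0 : (n : ℝ) ≠ 0 := by positivity
  have hn1 : (n : ℝ) - 1 ≠ 0 := by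
    have : (2 : ℝ) ≤ n := by exact_mod_cast hn
    linarith
  have hf : (n.factorial : ℝ) ≠ 0 := by positivity
  have hmean : ∫ ω, (∑ i, d i (perm ω i)) ∂P
      = (n : ℝ) * (((n : ℝ) ^ 2)⁻¹ * ∑ i, ∑ j, d i j) := by
    rw [integral_comp_uniform_perm P perm hpermMeas hpermUnif fun s => ∑ i, d i (s i),
      Finset.sum_comm, Finset.mul_sum, Finset.mul_sum, Finset.mul_sum]
    refine Finset.sum_congr rfl fun i _ => ?_
    have h := card_mul_sum_perm_apply (d i) i
    rw [Fintype.card_perm, Fintype.card_fin] at h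
    field_simp
    linarith
  refine ⟨hmean, ?_⟩
  have hT : Measurable fun ω => ∑ i, d i (perm ω i) :=
    (measurable_from_top : @Measurable _ _ ⊤ _ fun s : Equiv.Perm (Fin n) =>
      ∑ i, d i (s i)).comp hpermMeas
  rw [variance_eq_integral hT.aemeasurable, hmean]
  have hcomm : ∑ j, ∑ i, d i j = ∑ i, ∑ j, d i j := Finset.sum_comm
  set e : Fin n → Fin n → ℝ := fun i j =>
    d i j - (n : ℝ)⁻¹ * ∑ l, d i l - (n : ℝ)⁻¹ * ∑ k, d k j
      + ((n : ℝ) ^ 2)⁻¹ * ∑ k, ∑ l, d k l with he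
  have hrow : ∀ i, ∑ j, e i j = 0 := by
    intro i
    simp only [he, Finset.sum_add_distrib, Finset.sum_sub_distrib, ← Finset.mul_sum, hcomm,
      Finset.sum_const, Finset.card_univ, Fintype.card_fin, nsmul_eq_mul]
    field_simp
    ring
  have hcol : ∀ j, ∑ i, e i j = 0 := by
    intro j
    simp only [he, Finset.sum_add_distrib, Finset.sum_sub_distrib, ← Finset.mul_sum,
      Finset.sum_const, Finset.card_univ, Fintype.card_fin, nsmul_eq_mul]
    field_simp
    ring
  have hcenter : ∀ s : Equiv.Perm (Fin n), ∑ i, d i (s i)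
      - (n : ℝ) * (((n : ℝ) ^ 2)⁻¹ * ∑ i, ∑ j, d i j) = ∑ i, e i (s i) := by
    intro s
    have hs : ∑ i, ∑ k, d k (s i) = ∑ i, ∑ j, d i j :=
      (Equiv.sum_comp s fun j => ∑ k, d k j).trans hcomm
    simp only [he, Finset.sum_add_distrib, Finset.sum_sub_distrib, ← Finset.mul_sum, hs,
      Finset.sum_const, Finset.card_univ, Fintype.card_fin, nsmul_eq_mul]
    field_simp
    ring
  simp_rw [hcenter]
  rw [integral_comp_uniform_perm P perm hpermMeas hpermUnif fun s => (∑ i, e i (s i)) ^ 2]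
  have h := card_sub_one_mul_sum_perm_sq e hrow hcol
  rw [Fintype.card_perm, Fintype.card_fin] at h
  change _ = ((n : ℝ) - 1)⁻¹ * ∑ i, ∑ j, e i j ^ 2
  rw [inv_mul_eq_iff_eq_mul₀ hf, mul_left_comm, ← h, inv_mul_cancel_left₀ hn1]
end
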